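/- Let v ∈ C²(ω, ℝ^k) and w ∈ C¹(ω, ℝ^d) on an open domain ω ⊂ ℝ^d. Let {η_i ∈ ℝ^d}_{i=1…k} be unit vectors and {E_i ∈ ℝ^k}_{i=1…k} an orthonormal basis of ℝ^k. Given λ_i > 0 and a_i ∈ C²(ω, ℝ) for i = 1…k, define Γ(t) = 2 sin t, Γ̄(t) = −½ cos(2t), Γ̄̄(t) = −½ sin(2t), t_η = ⟨x, η⟩, and set ṽ = v + Σ_{i=1}^k (1/λ_i)·a_i·Γ(λ_i t_{η_i})·E_i and w̃ = w − Σ_{i=1}^k (1/λ_i)·a_i·Γ(λ_i t_{η_i})·∇⟨v, E_i⟩ − Σ_{i=1}^k (1/λ_i²)·a_i·Γ̄(λ_i t_{η_i})·∇a_i + Σ_{i=1}^k (1/λ_i)·a_i²·Γ̄̄(λ_i t_{η_i})·η_i. Then (½(∇ṽ)ᵀ∇ṽ + sym∇w̃) − (½(∇v)ᵀ∇v + sym∇w) − Σ_{i=1}^k a_i²·η_i⊗η_i = −Σ_{i=1}^k (1/λ_i)·a_i·Γ(λ_i t_{η_i})·∇²⟨v, E_i⟩ + Σ_{i=1}^k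 (1/λ_i²)·(½Γ(λ_i t_{η_i})² − Γ̄(λ_i t_{η_i}))·∇a_i⊗∇a_i − Σ_{i=1}^k (1/λ_i²)·a_i·Γ̄(λ_i t_{η_i})·∇²a_i. -/

import Mathlib

noncomputable section
open Real
open scoped BigOperators

/-- Partial derivative of `f` in the `i`-th coordinate direction. -/
def pd {d : ℕ} {E : Type*} [NormedAddCommGroup E] [NormedSpace ℝ E]
    (i : Fin d) (f : (Fin d → ℝ) → E) (x : Fin d → ℝ) : E :=
  fderiv ℝ f x (Pi.single i 1)

/-- The matrix `(∇v)ᵀ∇v`, with entries `⟨∂ᵢv, ∂ⱼv⟩`. -/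
def gradTgrad {d k : ℕ} (v : (Fin d → ℝ) → Fin k → ℝ) (x : Fin d → ℝ) :
    Fin d → Fin d → ℝ :=
  fun i j => ∑ l, pd i (fun y => v y l) x * pd j (fun y => v y l) x

/-- The symmetrized gradient `sym∇w = ½(∇w + (∇w)ᵀ)`. -/
def symGrad {d : ℕ} (w : (Fin d → ℝ) → Fin d → ℝ) (x : Fin d → ℝ) :
    Fin d → Fin d → ℝ :=
  fun i j => (pd i (fun y => w y j) x + pd j (fun y => w y i) x) / 2

section PartialDerivative

variable {d : ℕ} {f g : (Fin d → ℝ) → ℝ} {x : Fin d → ℝ}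

lemma pd_add (p : Fin d) (hf : DifferentiableAt ℝ f x) (hg : DifferentiableAt ℝ g x) :
    pd p (fun y => f y + g y) x = pd p f x + pd p g x := by
  simp [pd, fderiv_fun_add hf hg]

lemma pd_sub (p : Fin d) (hf : DifferentiableAt ℝ f x) (hg : DifferentiableAt ℝ g x) :
    pd p (fun y => f y - g y) x = pd p f x - pd p g x := by
  simp [pd, fderiv_fun_sub hf hg]

lemma pd_mul (p : Fin d) (hf : DifferentiableAt ℝ f x) (hg : DifferentiableAt ℝ g x) :
    pd p (fun y => f y * g y) x = pd p f x * g x + f x * pd p g x := by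
  simp [pd, fderiv_fun_mul hf hg]
  ring

lemma pd_mul_const (p : Fin d) (hf : DifferentiableAt ℝ f x) (c : ℝ) :
    pd p (fun y => f y * c) x = pd p f x * c := by
  simp [pd, fderiv_mul_const hf]
  ring

lemma pd_const_mul (p : Fin d) (hf : DifferentiableAt ℝ f x) (c : ℝ) :
    pd p (fun y => c * f y) x = c * pd p f x := by
  simp [pd, fderiv_const_mul hf]

lemma pd_sum {ι : Type*} [Fintype ι] {F : ι → (Fin d → ℝ) → ℝ} (p : Fin d)
    (hF : ∀ i, DifferentiableAt ℝ (F i) x) :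
    pd p (fun y => ∑ i, F i y) x = ∑ i, pd p (F i) x := by
  simp [pd, fderiv_fun_sum fun i _ => hF i]

lemma pd_linear (p : Fin d) (η : Fin d → ℝ) (x : Fin d → ℝ) :
    pd p (fun y => ∑ q, y q * η q) x = η p := by
  have hcoord (q : Fin d) : pd p (fun y : Fin d → ℝ => y q) x = if q = p then 1 else 0 := by
    simp [pd, fderiv_apply, Pi.single_apply]
  rw [pd_sum p fun q => by fun_prop]
  simp_rw [pd_mul_const p (differentiableAt_apply _ x), hcoord]
  simp

lemma pd_sin (p : Fin d) (hf : DifferentiableAt ℝ f x) :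
    pd p (fun y => Real.sin (f y)) x = Real.cos (f x) * pd p f x := by
  simp [pd, fderiv_sin hf]

lemma pd_cos (p : Fin d) (hf : DifferentiableAt ℝ f x) :
    pd p (fun y => Real.cos (f y)) x = -Real.sin (f x) * pd p f x := by
  simp [pd, fderiv_cos hf]

lemma pd_comm (p q : Fin d) (hf : ContDiffAt ℝ 2 f x) :
    pd p (fun y => pd q f y) x = pd q (fun y => pd p f y) x := by
  have hd : DifferentiableAt ℝ (fderiv ℝ f) x :=
    (hf.fderiv_right (m := 1) (by norm_num)).differentiableAt (by norm_num)
  have hsymm := hf.isSymmSndFDerivAt (by simp)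
  simp only [pd]
  rw [fderiv_clm_apply hd (by fun_prop), fderiv_clm_apply hd (by fun_prop)]
  simpa using hsymm.eq _ _

lemma ContDiffAt.differentiableAt_pd (p : Fin d) (hf : ContDiffAt ℝ 2 f x) :
    DifferentiableAt ℝ (fun y => pd p f y) x := by
  have hd : DifferentiableAt ℝ (fderiv ℝ f) x :=
    (hf.fderiv_right (m := 1) (by norm_num)).differentiableAt (by norm_num)
  exact hd.clm_apply (differentiableAt_const _)

end PartialDerivative

/-- The gradient of the scalar corrugation `a Γ(λ t_η) / λ`. -/
lemma pd_corrugation {d : ℕ} {a : (Fin d → ℝ) → ℝ} {x : Fin d → ℝ}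
    (ha : DifferentiableAt ℝ a x) {l : ℝ} (hl : l ≠ 0) (η : Fin d → ℝ) (p : Fin d) :
    pd p (fun y => (1 / l) * a y * (2 * Real.sin (l * ∑ q, y q * η q))) x
      = (1 / l) * pd p a x * (2 * Real.sin (l * ∑ q, x q * η q))
        + a x * (2 * Real.cos (l * ∑ q, x q * η q)) * η p := by
  rw [pd_mul p (by fun_prop) (by fun_prop), pd_const_mul p ha, pd_const_mul p (by fun_prop),
    pd_sin p (by fun_prop), pd_const_mul p (by fun_prop), pd_linear]
  field_simp

lemma pd_corrugation_cos {d : ℕ} {a : (Fin d → ℝ) → ℝ} {x : Fin d → ℝ}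
    (ha : DifferentiableAt ℝ a x) {l : ℝ} (hl : l ≠ 0) (η : Fin d → ℝ) (p : Fin d) :
    pd p (fun y => (1 / l ^ 2) * a y * (-(1/2) * Real.cos (2 * (l * ∑ q, y q * η q)))) x
      = (1 / l ^ 2) * pd p a x * (-(1/2) * Real.cos (2 * (l * ∑ q, x q * η q)))
        + (1 / l) * a x * Real.sin (2 * (l * ∑ q, x q * η q)) * η p := by
  rw [pd_mul p (by fun_prop) (by fun_prop), pd_const_mul p ha, pd_const_mul p (by fun_prop),
    pd_cos p (by fun_prop), pd_const_mul p (by fun_prop), pd_const_mul p (by fun_prop), pd_linear]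
  field_simp

lemma pd_corrugation_sin {d : ℕ} {a : (Fin d → ℝ) → ℝ} {x : Fin d → ℝ}
    (ha : DifferentiableAt ℝ a x) {l : ℝ} (hl : l ≠ 0) (η : Fin d → ℝ) (p : Fin d) :
    pd p (fun y => (1 / l) * a y ^ 2 * (-(1/2) * Real.sin (2 * (l * ∑ q, y q * η q)))) x
      = -(1 / l) * a x * pd p a x * Real.sin (2 * (l * ∑ q, x q * η q))
        - a x ^ 2 * Real.cos (2 * (l * ∑ q, x q * η q)) * η p := by
  simp_rw [pow_two]
  rw [pd_mul p (by fun_prop) (by fun_prop), pd_const_mul p (by fun_prop), pd_mul p ha ha,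
    pd_const_mul p (by fun_prop), pd_sin p (by fun_prop), pd_const_mul p (by fun_prop),
    pd_const_mul p (by fun_prop), pd_linear]
  field_simp
  ring

/-- Expansion of `⟨u + ∑ Bᵢ Eᵢ, u' + ∑ B'ᵢ Eᵢ⟩` for an orthonormal family `E`. -/
lemma sum_add_orthonormal_mul {k : ℕ} {E : Fin k → Fin k → ℝ}
    (hE : ∀ i i', ∑ l, E i l * E i' l = if i = i' then (1:ℝ) else 0)
    (u u' B B' : Fin k → ℝ) :
    ∑ l, (u l + ∑ i, B i * E i l) * (u' l + ∑ i, B' i * E i l)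
      = ∑ l, u l * u' l
        + ∑ i, (B' i * (∑ l, u l * E i l) + B i * (∑ l, u' l * E i l) + B i * B' i) := by
  have cross (u B : Fin k → ℝ) :
      ∑ l, u l * ∑ i, B i * E i l = ∑ i, B i * ∑ l, u l * E i l := by
    simp_rw [Finset.mul_sum]
    rw [Finset.sum_comm]
    exact Finset.sum_congr rfl fun i _ => Finset.sum_congr rfl fun l _ => by ring
  have diag : ∑ l, (∑ i, B i * E i l) * ∑ i, B' i * E i l = ∑ i, B i * B' i := by
    rw [cross]
    refine Finset.sum_congr rfl fun i _ => ?_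
    have hi : ∑ l, (∑ j, B j * E j l) * E i l = ∑ j, B j * ∑ l, E j l * E i l := by
      simp_rw [mul_comm _ (E i _)]
      rw [cross]
    rw [hi]
    simp [hE, mul_comm]
  simp_rw [add_mul, mul_add, Finset.sum_add_distrib]
  rw [cross u B', diag]
  have h : ∑ l, (∑ i, B i * E i l) * u' l = ∑ i, B i * ∑ l, u' l * E i l := by
    simp_rw [mul_comm _ (u' _)]
    exact cross u' B
  rw [h]
  ring

lemma combine_sums {ι : Type*} [Fintype ι] {G W W' : ℝ}
    {S C₁ C₂ C₃ D₁ D₂ D₃ A F₁ F₂ F₃ : ι → ℝ}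
    (h : ∀ i, (1/2) * S i + ((-C₁ i - C₂ i + C₃ i) + (-D₁ i - D₂ i + D₃ i)) / 2 - A i
      = -F₁ i + F₂ i - F₃ i) :
    ((1/2) * (G + ∑ i, S i)
          + ((W - ∑ i, C₁ i - ∑ i, C₂ i + ∑ i, C₃ i)
            + (W' - ∑ i, D₁ i - ∑ i, D₂ i + ∑ i, D₃ i)) / 2)
        - ((1/2) * G + (W + W') / 2) - ∑ i, A i
      = -∑ i, F₁ i + ∑ i, F₂ i - ∑ i, F₃ i := by
  have hsum := Finset.sum_congr rfl fun i (_ : i ∈ Finset.univ) => h i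
  simp only [Finset.sum_add_distrib, Finset.sum_sub_distrib, Finset.sum_neg_distrib,
    ← Finset.mul_sum, ← Finset.sum_div] at hsum
  linarith

/-- Corollary 2.2: superposition of `k` corrugation "steps" in mutually orthogonal
codimension directions accumulates the errors linearly. -/
theorem steps_corrugation_superposition
    {d k : ℕ} (ω : Set (Fin d → ℝ)) (hω : IsOpen ω)
    (v : (Fin d → ℝ) → Fin k → ℝ) (w : (Fin d → ℝ) → Fin d → ℝ)
    (hv : ContDiffOn ℝ 2 v ω) (hw : ContDiffOn ℝ 1 w ω)
    (η : Fin k → Fin d → ℝ) (hη : ∀ i, ∑ p, η i p ^ 2 = 1)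
    (E : Fin k → Fin k → ℝ)
    (hE : ∀ i i', ∑ l, E i l * E i' l = if i = i' then (1:ℝ) else 0)
    (lam : Fin k → ℝ) (hlam : ∀ i, 0 < lam i)
    (a : Fin k → (Fin d → ℝ) → ℝ) (ha : ∀ i, ContDiffOn ℝ 2 (a i) ω)
    (vt : (Fin d → ℝ) → Fin k → ℝ) (wt : (Fin d → ℝ) → Fin d → ℝ)
    (hvt : vt = fun x l => v x l
      + ∑ i, (1 / lam i) * a i x
          * (2 * Real.sin (lam i * ∑ p, x p * η i p)) * E i l)
    (hwt : wt = fun x j => w x j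
      - ∑ i, (1 / lam i) * a i x * (2 * Real.sin (lam i * ∑ p, x p * η i p))
          * pd j (fun y => ∑ l, v y l * E i l) x
      - ∑ i, (1 / (lam i) ^ 2) * a i x
          * (-(1/2) * Real.cos (2 * (lam i * ∑ p, x p * η i p))) * pd j (a i) x
      + ∑ i, (1 / lam i) * a i x ^ 2
          * (-(1/2) * Real.sin (2 * (lam i * ∑ p, x p * η i p))) * η i j) :
    ∀ x ∈ ω, ∀ p q : Fin d,
      ((1/2) * gradTgrad vt x p q + symGrad wt x p q)
        - ((1/2) * gradTgrad v x p q + symGrad w x p q)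
        - ∑ i, a i x ^ 2 * η i p * η i q
      = - ∑ i, (1 / lam i) * a i x * (2 * Real.sin (lam i * ∑ p', x p' * η i p'))
            * pd p (fun y => pd q (fun z => ∑ l, v z l * E i l) y) x
        + ∑ i, (1 / (lam i) ^ 2)
            * ((1/2) * (2 * Real.sin (lam i * ∑ p', x p' * η i p')) ^ 2
                - (-(1/2) * Real.cos (2 * (lam i * ∑ p', x p' * η i p'))))
            * pd p (a i) x * pd q (a i) x
        - ∑ i, (1 / (lam i) ^ 2) * a i x
            * (-(1/2) * Real.cos (2 * (lam i * ∑ p', x p' * η i p')))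
            * pd p (fun y => pd q (a i) y) x := by
  intro x hx p q
  have hω' := hω.mem_nhds hx
  have hv2 (l) : ContDiffAt ℝ 2 (fun y => v y l) x := contDiffAt_pi.1 (hv.contDiffAt hω') l
  have hv1 (l) : DifferentiableAt ℝ (fun y => v y l) x := (hv2 l).differentiableAt (by norm_num)
  have hw1 (j) : DifferentiableAt ℝ (fun y => w y j) x :=
    (contDiffAt_pi.1 (hw.contDiffAt hω') j).differentiableAt (by norm_num)
  have ha2 (i) : ContDiffAt ℝ 2 (a i) x := (ha i).contDiffAt hω'
  have ha1 (i) : DifferentiableAt ℝ (a i) x := (ha2 i).differentiableAt (by norm_num)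
  have hV2 (i) : ContDiffAt ℝ 2 (fun y => ∑ l, v y l * E i l) x :=
    ContDiffAt.sum fun l _ => (hv2 l).mul contDiffAt_const
  have hpV (i j) := (hV2 i).differentiableAt_pd j
  have hpa (i j) := (ha2 i).differentiableAt_pd j
  have hl (i) : lam i ≠ 0 := (hlam i).ne'
  have pdV (i j) : pd j (fun y => ∑ l, v y l * E i l) x
      = ∑ l, pd j (fun y => v y l) x * E i l := by
    rw [pd_sum j fun l => (hv1 l).mul_const _]
    exact Finset.sum_congr rfl fun l _ => pd_mul_const j (hv1 l) _
  have hvt' (j l) : pd j (fun y => vt y l) x = pd j (fun y => v y l) x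
      + ∑ i, ((1 / lam i) * pd j (a i) x * (2 * Real.sin (lam i * ∑ q, x q * η i q))
        + a i x * (2 * Real.cos (lam i * ∑ q, x q * η i q)) * η i j) * E i l := by
    subst hvt
    rw [pd_add j (hv1 l) (by fun_prop), pd_sum j fun i => by fun_prop]
    congr 1
    refine Finset.sum_congr rfl fun i _ => ?_
    rw [pd_mul_const j (by fun_prop), pd_corrugation (ha1 i) (hl i)]
  have hwt' (j m) : pd j (fun y => wt y m) x = pd j (fun y => w y m) x
      - ∑ i, (((1 / lam i) * pd j (a i) x * (2 * Real.sin (lam i * ∑ q, x q * η i q))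
          + a i x * (2 * Real.cos (lam i * ∑ q, x q * η i q)) * η i j)
            * pd m (fun y => ∑ l, v y l * E i l) x
          + (1 / lam i) * a i x * (2 * Real.sin (lam i * ∑ q, x q * η i q))
            * pd j (fun y => pd m (fun z => ∑ l, v z l * E i l) y) x)
      - ∑ i, (((1 / lam i ^ 2) * pd j (a i) x
            * (-(1/2) * Real.cos (2 * (lam i * ∑ q, x q * η i q)))
          + (1 / lam i) * a i x * Real.sin (2 * (lam i * ∑ q, x q * η i q)) * η i j)
            * pd m (a i) x
          + (1 / lam i ^ 2) * a i x * (-(1/2) * Real.cos (2 * (lam i * ∑ q, x q * η i q)))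
            * pd j (fun y => pd m (a i) y) x)
      + ∑ i, (-(1 / lam i) * a i x * pd j (a i) x
            * Real.sin (2 * (lam i * ∑ q, x q * η i q))
          - a i x ^ 2 * Real.cos (2 * (lam i * ∑ q, x q * η i q)) * η i j) * η i m := by
    subst hwt
    rw [pd_add j (by fun_prop) (by fun_prop), pd_sub j (by fun_prop) (by fun_prop),
      pd_sub j (by fun_prop) (by fun_prop), pd_sum j fun i => by fun_prop,
      pd_sum j fun i => by fun_prop, pd_sum j fun i => by fun_prop]
    congr 1
    · congr 1
      · congr 1
        refine Finset.sum_congr rfl fun i _ => ?_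
        rw [pd_mul j (by fun_prop) (hpV i m), pd_corrugation (ha1 i) (hl i)]
      · refine Finset.sum_congr rfl fun i _ => ?_
        rw [pd_mul j (by fun_prop) (hpa i m), pd_corrugation_cos (ha1 i) (hl i)]
    · refine Finset.sum_congr rfl fun i _ => ?_
      rw [pd_mul_const j (by fun_prop), pd_corrugation_sin (ha1 i) (hl i)]
  simp only [gradTgrad, symGrad, hwt']
  simp_rw [hvt']
  rw [sum_add_orthonormal_mul hE]
  simp_rw [← pdV, fun i => pd_comm q p (hV2 i), fun i => pd_comm q p (ha2 i)]
  refine combine_sums fun i => ?_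
  rw [Real.sin_two_mul, Real.cos_two_mul]
  ring
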